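/- Let B := {ξ ∈ ℝ^{d+1} : ‖ξ‖ ≤ 1} be the closed unit ball of ℝ^{d+1}, equipped with the metric ρ(ξ, η) := ‖ξ − η‖ + |√(1 − ‖ξ‖²) − √(1 − ‖η‖²)|, and for ξ ∈ B, r > 0 let B_ρ(ξ, r) := {η ∈ B : ρ(ξ, η) ≤ r}. Let n ∈ ℕ and 0 < p ≤ ∞. Then there exists ε ∈ (0, 1), depending only on p and d, with the following property: whenever ξ₁, …, ξ_m ∈ B satisfy ρ(ξ_i, ξ_j) ≥ 1/n for all i ≠ j, setting E := ∪_{j=1}^m B_ρ(ξ_j, ε/n), every algebraic polynomial f on ℝ^{d+1} of total degree ≤ n satisfies ‖f‖_{L^p(B)} ≤ C · ‖f‖_{L^p(B \ E)}, where C depends only on d and p. -/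

import Mathlib

open MeasureTheory ENNReal NNReal

noncomputable section

/-- the ball metric `ρ(ξ,η) = ‖ξ−η‖ + |√(1−‖ξ‖²) − √(1−‖η‖²)|` on the unit ball -/
def rhoB {d : ℕ} (x y : EuclideanSpace ℝ (Fin (d + 1))) : ℝ :=
  ‖x - y‖ + |Real.sqrt (1 - ‖x‖ ^ 2) - Real.sqrt (1 - ‖y‖ ^ 2)|

lemma log_norm_le_circleAverage {f : ℂ → ℂ} {c : ℂ} {R : ℝ} (hR : R ≠ 0)
    (hf : AnalyticOnNhd ℂ f (Metric.closedBall c |R|)) (hc : f c ≠ 0) :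
    Real.log ‖f c‖ ≤ Real.circleAverage (fun z => Real.log ‖f z‖) c R := by
  have h := hf.circleAverage_log_norm hR hc
  rw [h, le_add_iff_nonneg_left]
  refine finsum_nonneg fun u => ?_
  by_cases hu : u ∈ Metric.closedBall c |R|
  · refine mul_nonneg ?_ ?_
    · have := (MeromorphicOn.AnalyticOnNhd.divisor_nonneg hf) u
      exact_mod_cast this
    · rw [← Real.log_abs, abs_mul, abs_inv, abs_norm]
      rcases eq_or_ne c u with rfl | hne
      · simp
      · have h0 : 0 < ‖c - u‖ := norm_pos_iff.2 (sub_ne_zero.2 hne)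
        apply Real.log_nonneg
        rw [← div_eq_mul_inv, one_le_div h0, ← dist_eq_norm, dist_comm]
        exact hu
  · rw [Function.locallyFinsuppWithin.apply_eq_zero_of_notMem _ hu]
    simp

/-- The sub-mean value property of `‖h‖ ^ p * ‖k‖` for analytic `h` and `k`. -/
lemma rpow_norm_mul_norm_le_circleAverage {h k : ℂ → ℂ} {c : ℂ} {R p : ℝ} (hR : R ≠ 0)
    (hp : 0 < p) (hh : AnalyticOnNhd ℂ h (Metric.closedBall c |R|))
    (hk : AnalyticOnNhd ℂ k (Metric.closedBall c |R|)) :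
    ‖h c‖ ^ p * ‖k c‖ ≤ Real.circleAverage (fun z => ‖h z‖ ^ p * ‖k z‖) c R := by
  have hnn : ∀ z, 0 ≤ ‖h z‖ ^ p * ‖k z‖ := fun z => by positivity
  by_cases hhc : h c = 0
  · rw [hhc, norm_zero, Real.zero_rpow hp.ne', zero_mul]
    exact Real.circleAverage_nonneg_of_nonneg fun z _ => hnn z
  by_cases hkc : k c = 0
  · rw [hkc, norm_zero, mul_zero]
    exact Real.circleAverage_nonneg_of_nonneg fun z _ => hnn z
  have hcmem : c ∈ Metric.closedBall c |R| := Metric.mem_closedBall_self (abs_nonneg R)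
  have hpre : IsConnected (Metric.closedBall c |R|) :=
    ⟨⟨c, hcmem⟩, (convex_closedBall c |R|).isPreconnected⟩
  have hsub : Metric.sphere c |R| ⊆ Metric.closedBall c |R| := Metric.sphere_subset_closedBall
  have h1 := Filter.codiscreteWithin_mono hsub
    (hh.preimage_zero_mem_codiscreteWithin hhc hcmem hpre)
  have h2 := Filter.codiscreteWithin_mono hsub
    (hk.preimage_zero_mem_codiscreteWithin hkc hcmem hpre)
  set a : ℝ := p * Real.log ‖h c‖ + Real.log ‖k c‖ with ha
  set φ : ℂ → ℝ := fun z => p * Real.log ‖h z‖ + Real.log ‖k z‖ with hφ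
  have hexp : ∀ z, h z ≠ 0 → k z ≠ 0 →
      ‖h z‖ ^ p * ‖k z‖ = Real.exp (p * Real.log ‖h z‖ + Real.log ‖k z‖) := by
    intro z hz hz'
    rw [Real.exp_add, Real.exp_log (norm_pos_iff.2 hz'), Real.rpow_def_of_pos (norm_pos_iff.2 hz),
      mul_comm p]
  have hih : CircleIntegrable (fun z => Real.log ‖h z‖) c R :=
    MeromorphicOn.circleIntegrable_log_norm (hh.mono hsub).meromorphicOn
  have hik : CircleIntegrable (fun z => Real.log ‖k z‖) c R :=
    MeromorphicOn.circleIntegrable_log_norm (hk.mono hsub).meromorphicOn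
  have hihp : CircleIntegrable (fun z => p * Real.log ‖h z‖) c R := by
    have := IntervalIntegrable.const_mul hih p
    exact this
  have hφi : CircleIntegrable φ c R := hihp.add hik
  have haφ : a ≤ Real.circleAverage φ c R := by
    rw [hφ, Real.circleAverage_fun_add hihp hik]
    have : Real.circleAverage (fun z => p * Real.log ‖h z‖) c R
        = p * Real.circleAverage (fun z => Real.log ‖h z‖) c R := by
      simpa [smul_eq_mul] using
        Real.circleAverage_fun_smul (a := p) (f := fun z => Real.log ‖h z‖) (c := c) (R := R)
    rw [this]
    have e1 := log_norm_le_circleAverage hR hh hhc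
    have e2 := log_norm_le_circleAverage hR hk hkc
    exact add_le_add (mul_le_mul_of_nonneg_left e1 hp.le) e2
  set T : ℂ → ℝ := fun z => Real.exp a * (1 - a) + Real.exp a * φ z with hT
  set T' : ℂ → ℝ := fun z => min (T z) (‖h z‖ ^ p * ‖k z‖) with hT'
  have hc1 : CircleIntegrable (fun z => Real.exp a * φ z) c R := IntervalIntegrable.const_mul hφi _
  have hTi : CircleIntegrable T c R := (circleIntegrable_const _ c R).add hc1
  have hTT' : T =ᶠ[Filter.codiscreteWithin (Metric.sphere c |R|)] T' := by
    filter_upwards [h1, h2] with z hz hz'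
    have hz1 : h z ≠ 0 := by simpa using hz
    have hz2 : k z ≠ 0 := by simpa using hz'
    have : T z ≤ ‖h z‖ ^ p * ‖k z‖ := by
      rw [hexp z hz1 hz2]
      have := Real.add_one_le_exp (φ z - a)
      rw [Real.exp_sub, le_div_iff₀ (Real.exp_pos a)] at this
      simp only [hT]
      linarith
    simp [hT', this]
  have hT'i : CircleIntegrable T' c R := CircleIntegrable.congr_codiscreteWithin hTT' hTi
  have hUi : CircleIntegrable (fun z => ‖h z‖ ^ p * ‖k z‖) c R := by
    refine ContinuousOn.circleIntegrable' ?_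
    have a1 := (hh.mono hsub).continuousOn
    have a2 := (hk.mono hsub).continuousOn
    exact (a1.norm.rpow_const fun x _ => Or.inr hp.le).mul a2.norm
  calc ‖h c‖ ^ p * ‖k c‖ = Real.exp a := hexp c hhc hkc
    _ ≤ Real.exp a * (1 - a) + Real.exp a * Real.circleAverage φ c R := by
        nlinarith [Real.exp_pos a]
    _ = Real.circleAverage T c R := by
        rw [hT, Real.circleAverage_fun_add (circleIntegrable_const _ c R) hc1,
          Real.circleAverage_const]
        congr 1
        simpa [smul_eq_mul] using
          (Real.circleAverage_fun_smul (a := Real.exp a) (f := φ) (c := c) (R := R)).symm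
    _ = Real.circleAverage T' c R := Real.circleAverage_congr_codiscreteWithin hTT' hR
    _ ≤ _ := Real.circleAverage_mono hT'i hUi fun z _ => min_le_right _ _

lemma circleAverage_comp_mul_of_norm_eq_one (F : ℂ → ℝ) {w : ℂ} (hw : ‖w‖ = 1) :
    Real.circleAverage (fun z => F (z * w)) 0 1 = Real.circleAverage F 0 1 := by
  rw [Real.circleAverage_eq_integral_add (f := F) w.arg]
  unfold Real.circleAverage
  congr 2
  ext θ
  have : w = circleMap 0 1 w.arg := by
    rw [circleMap_zero]
    conv_lhs => rw [← Complex.norm_mul_exp_arg_mul_I w, hw]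
  change F (circleMap 0 1 θ * w) = F (circleMap 0 1 (θ + w.arg))
  conv_lhs => rw [this, circleMap_zero_mul, one_mul]

/-- Circle means of `‖h‖ ^ p * ‖k‖` around the origin do not exceed the mean over the unit
circle. -/
lemma circleAverage_rpow_norm_mul_norm_le {h k : ℂ → ℂ} {r p : ℝ} (hp : 0 < p)
    (hh : Differentiable ℂ h) (hk : Differentiable ℂ k) (hr0 : 0 ≤ r) (hr1 : r < 1) :
    Real.circleAverage (fun z => ‖h z‖ ^ p * ‖k z‖) 0 r ≤
      Real.circleAverage (fun z => ‖h z‖ ^ p * ‖k z‖) 0 1 := by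
  set U : ℂ → ℝ := fun z => ‖h z‖ ^ p * ‖k z‖ with hU
  have hUc : Continuous U :=
    (hh.continuous.norm.rpow_const fun x => Or.inr hp.le).mul hk.continuous.norm
  set φ : ℂ → ℂ := fun w => (w + r) / (1 + r * w) with hφ
  have hne : ∀ w ∈ Metric.closedBall (0 : ℂ) |(1 : ℝ)|, (1 + r * w : ℂ) ≠ 0 := by
    intro w hw h0
    have h1 : ‖(r * w : ℂ)‖ = 1 := by
      rw [show (r * w : ℂ) = -1 by linear_combination h0]; simp
    rw [norm_mul, Complex.norm_real, Real.norm_of_nonneg hr0] at h1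
    have hw1 : ‖w‖ ≤ 1 := by simpa using hw
    nlinarith [norm_nonneg w]
  have hφa : AnalyticOnNhd ℂ φ (Metric.closedBall (0 : ℂ) |(1 : ℝ)|) := by
    intro w hw
    exact (by fun_prop : AnalyticAt ℂ (fun w : ℂ => w + r) w).div (by fun_prop) (hne w hw)
  have hφ1 : ∀ t, ‖φ (circleMap 0 1 t)‖ = 1 := by
    intro t
    set w := circleMap 0 1 t
    have hw : ‖w‖ = 1 := by simp [w]
    have hww : w * (starRingEnd ℂ) w = 1 := by
      rw [Complex.mul_conj, Complex.normSq_eq_norm_sq, hw]; simp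
    have : (w + r : ℂ) = w * (starRingEnd ℂ) (1 + r * w) := by
      simp only [map_add, map_mul, map_one, Complex.conj_ofReal]
      linear_combination (-(r : ℂ)) * hww
    simp only [hφ]
    rw [this, norm_div, norm_mul, RCLike.norm_conj, hw, one_mul, div_self]
    exact norm_ne_zero_iff.2 (hne w (by simp [hw]))
  have hφc : Continuous fun t => φ (circleMap 0 1 t) := by
    refine Continuous.div (by fun_prop) (by fun_prop) fun t => hne _ (by simp)
  have hzr : ∀ θ, circleMap 0 r θ = circleMap 0 1 θ * r := by
    intro θ; simp [circleMap_zero, mul_comm]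
  have hpt : ∀ θ, U (circleMap 0 r θ) ≤
      (2 * Real.pi)⁻¹ * ∫ t in (0)..2 * Real.pi, U (circleMap 0 1 θ * φ (circleMap 0 1 t)) := by
    intro θ
    have a1 : AnalyticOnNhd ℂ (fun w => h (circleMap 0 1 θ * φ w))
        (Metric.closedBall (0 : ℂ) |(1 : ℝ)|) := fun w hw =>
      AnalyticAt.fun_comp (hh.analyticAt _) (analyticAt_const.mul (hφa w hw))
    have a2 : AnalyticOnNhd ℂ (fun w => k (circleMap 0 1 θ * φ w))
        (Metric.closedBall (0 : ℂ) |(1 : ℝ)|) := fun w hw =>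
      AnalyticAt.fun_comp (hk.analyticAt _) (analyticAt_const.mul (hφa w hw))
    have := rpow_norm_mul_norm_le_circleAverage one_ne_zero hp a1 a2
    simp only [Real.circleAverage, smul_eq_mul] at this
    rw [hzr]
    simpa [hφ, hU] using this
  have hcont2 : Continuous fun q : ℝ × ℝ => U (circleMap 0 1 q.1 * φ (circleMap 0 1 q.2)) := by
    refine hUc.comp (Continuous.mul (by fun_prop) ?_)
    exact hφc.comp continuous_snd
  have hpi : (0 : ℝ) ≤ 2 * Real.pi := by positivity
  have hcI : Continuous fun θ =>
      ∫ t in (0)..2 * Real.pi, U (circleMap 0 1 θ * φ (circleMap 0 1 t)) :=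
    intervalIntegral.continuous_parametric_intervalIntegral_of_continuous' hcont2 _ _
  simp only [Real.circleAverage, smul_eq_mul]
  gcongr
  calc ∫ θ in (0)..2 * Real.pi, U (circleMap 0 r θ)
      ≤ ∫ θ in (0)..2 * Real.pi, (2 * Real.pi)⁻¹ *
          ∫ t in (0)..2 * Real.pi, U (circleMap 0 1 θ * φ (circleMap 0 1 t)) := by
        refine intervalIntegral.integral_mono_on hpi ?_ ?_ fun θ _ => hpt θ
        · exact (hUc.comp (continuous_circleMap 0 r)).intervalIntegrable _ _
        · exact (continuous_const.mul hcI).intervalIntegrable _ _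
    _ = (2 * Real.pi)⁻¹ * ∫ t in (0)..2 * Real.pi, ∫ θ in (0)..2 * Real.pi,
          U (circleMap 0 1 θ * φ (circleMap 0 1 t)) := by
        rw [intervalIntegral.integral_const_mul]
        congr 1
        rw [intervalIntegral_intervalIntegral_swap]
        rw [Set.uIoc_of_le hpi]
        refine (hcont2.continuousOn.integrableOn_compact
          ((isCompact_Icc (a := 0) (b := 2 * Real.pi)).prod
            (isCompact_Icc (a := 0) (b := 2 * Real.pi)))).mono_set ?_
        exact Set.prod_mono Set.Ioc_subset_Icc_self Set.Ioc_subset_Icc_self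
    _ = (2 * Real.pi)⁻¹ * ∫ t in (0)..2 * Real.pi, ∫ θ in (0)..2 * Real.pi,
          U (circleMap 0 1 θ) := by
        congr 1
        refine intervalIntegral.integral_congr fun t _ => ?_
        have := circleAverage_comp_mul_of_norm_eq_one U (hφ1 t)
        simp only [Real.circleAverage, smul_eq_mul] at this
        exact mul_left_cancel₀ (by positivity) this
    _ = _ := by
        rw [intervalIntegral.integral_const, smul_eq_mul]
        field_simp
        ring

/-- The polynomial `w ↦ w ^ n * G ((w + w⁻¹) / 2)`. -/
def laurentLift (n : ℕ) (G : Polynomial ℂ) (w : ℂ) : ℂ :=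
  ∑ k ∈ Finset.range (n + 1), G.coeff k * ((w ^ 2 + 1) / 2) ^ k * w ^ (n - k)

lemma differentiable_laurentLift (n : ℕ) (G : Polynomial ℂ) :
    Differentiable ℂ (laurentLift n G) := by
  unfold laurentLift
  fun_prop

lemma laurentLift_exp {n : ℕ} {G : Polynomial ℂ} (hG : G.natDegree ≤ n) (z : ℂ) :
    laurentLift n G (Complex.exp (z * Complex.I)) =
      Complex.exp (z * Complex.I) ^ n * G.eval (Complex.cos z) := by
  rw [Polynomial.eval_eq_sum_range' (Nat.lt_succ_of_le hG), Finset.mul_sum, laurentLift]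
  refine Finset.sum_congr rfl fun k hk => ?_
  have hk' : k ≤ n := Nat.lt_succ_iff.1 (Finset.mem_range.1 hk)
  have h : (Complex.exp (z * Complex.I) ^ 2 + 1) / 2 =
      Complex.exp (z * Complex.I) * Complex.cos z := by
    rw [Complex.cos, neg_mul, Complex.exp_neg]
    field_simp [Complex.exp_ne_zero]
  rw [h, mul_pow]
  have : Complex.exp (z * Complex.I) ^ n =
      Complex.exp (z * Complex.I) ^ k * Complex.exp (z * Complex.I) ^ (n - k) := by
    rw [← pow_add, Nat.add_sub_cancel' hk']
  rw [this]
  ring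

lemma exp_mul_I_sq_sub_one (z : ℂ) :
    (Complex.exp (z * Complex.I) ^ 2 - 1) / 2 =
      Complex.exp (z * Complex.I) * (Complex.I * Complex.sin z) := by
  rw [Complex.sin, neg_mul, Complex.exp_neg]
  field_simp [Complex.exp_ne_zero]
  rw [Complex.I_sq]
  ring

lemma norm_exp_mul_I (x y : ℝ) :
    ‖Complex.exp ((x + y * Complex.I) * Complex.I)‖ = Real.exp (-y) := by
  rw [Complex.norm_exp]
  simp

lemma exp_mul_I_eq_circleMap (x y : ℝ) :
    Complex.exp ((x + y * Complex.I) * Complex.I) = circleMap 0 (Real.exp (-y)) x := by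
  rw [circleMap_zero, Complex.ofReal_exp, ← Complex.exp_add]
  congr 1
  push_cast
  linear_combination (y : ℂ) * Complex.I_sq

/-- The function `|G (cos z)| ^ p * |sin z|`, an `L ^ p` density in the variable `s = cos z`. -/
def cosDensity (p : ℝ) (G : Polynomial ℂ) (z : ℂ) : ℝ :=
  ‖G.eval (Complex.cos z)‖ ^ p * ‖Complex.sin z‖

section cosDensity

variable {p : ℝ} {G : Polynomial ℂ}

lemma cosDensity_nonneg (z : ℂ) : 0 ≤ cosDensity p G z := by
  unfold cosDensity; positivity

lemma differentiable_eval_cos (G : Polynomial ℂ) :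
    Differentiable ℂ fun z : ℂ => G.eval (Complex.cos z) :=
  G.differentiable.comp Complex.differentiable_cos

lemma continuous_cosDensity (hp : 0 < p) : Continuous (cosDensity p G) :=
  ((differentiable_eval_cos G).continuous.norm.rpow_const fun _ => Or.inr hp.le).mul
    Complex.continuous_sin.norm

lemma cosDensity_neg (z : ℂ) : cosDensity p G (-z) = cosDensity p G z := by
  simp [cosDensity]

lemma cosDensity_add_two_pi (z : ℂ) : cosDensity p G (z + 2 * Real.pi) = cosDensity p G z := by
  simp [cosDensity, Complex.cos_add_two_pi, Complex.sin_add_two_pi]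

lemma periodic_cosDensity (y : ℝ) :
    Function.Periodic (fun x : ℝ => cosDensity p G (x + y * Complex.I)) (2 * Real.pi) := by
  intro x
  simp only
  rw [← cosDensity_add_two_pi (x + y * Complex.I)]
  congr 1
  push_cast
  ring

lemma cosDensity_eq {n : ℕ} (hG : G.natDegree ≤ n) (x y : ℝ) :
    cosDensity p G (x + y * Complex.I) = Real.exp ((p * n + 1) * y) *
      (‖laurentLift n G (circleMap 0 (Real.exp (-y)) x)‖ ^ p *
        ‖(circleMap 0 (Real.exp (-y)) x ^ 2 - 1) / 2‖) := by
  rw [← exp_mul_I_eq_circleMap, laurentLift_exp hG, exp_mul_I_sq_sub_one, norm_mul, norm_mul,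
    norm_mul, norm_pow, norm_exp_mul_I, Complex.norm_I, one_mul,
    Real.mul_rpow (by positivity) (by positivity), ← Real.exp_nat_mul, ← Real.exp_mul, cosDensity]
  have : Real.exp ((p * n + 1) * y) * (Real.exp (n * -y * p) * Real.exp (-y)) = 1 := by
    rw [← Real.exp_add, ← Real.exp_add, Real.exp_eq_one_iff]
    ring
  linear_combination (-(‖G.eval (Complex.cos (x + y * Complex.I))‖ ^ p *
    ‖Complex.sin (x + y * Complex.I)‖)) * this

lemma integral_cosDensity_le_of_pos {n : ℕ} (hp : 0 < p) (hG : G.natDegree ≤ n) {y : ℝ}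
    (hy : 0 < y) :
    ∫ x in (0 : ℝ)..2 * Real.pi, cosDensity p G (x + y * Complex.I) ≤
      Real.exp ((p * n + 1) * y) * ∫ x in (0 : ℝ)..2 * Real.pi, cosDensity p G x := by
  have h0 : ∀ x : ℝ, cosDensity p G x =
      ‖laurentLift n G (circleMap 0 1 x)‖ ^ p * ‖(circleMap 0 1 x ^ 2 - 1) / 2‖ := by
    intro x
    simpa using cosDensity_eq (p := p) hG x 0
  simp_rw [cosDensity_eq hG, h0, intervalIntegral.integral_const_mul]
  refine mul_le_mul_of_nonneg_left ?_ (Real.exp_pos _).le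
  have := circleAverage_rpow_norm_mul_norm_le (k := fun w => (w ^ 2 - 1) / 2) hp
    (differentiable_laurentLift n G) (by fun_prop) (Real.exp_pos (-y)).le
    (Real.exp_lt_one_iff.2 (neg_lt_zero.2 hy))
  simp only [Real.circleAverage, smul_eq_mul] at this
  exact le_of_mul_le_mul_left this (by positivity)

lemma integral_cosDensity_le {n : ℕ} (hp : 0 < p) (hG : G.natDegree ≤ n) (y : ℝ) :
    ∫ x in (0 : ℝ)..2 * Real.pi, cosDensity p G (x + y * Complex.I) ≤
      Real.exp ((p * n + 1) * |y|) * ∫ x in (0 : ℝ)..2 * Real.pi, cosDensity p G x := by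
  rcases lt_trichotomy y 0 with hy | rfl | hy
  · have h := integral_cosDensity_le_of_pos hp hG (neg_pos.2 hy)
    rw [abs_of_neg hy]
    convert h using 1
    have h2 := intervalIntegral.integral_comp_neg (a := 0) (b := 2 * Real.pi)
      fun x : ℝ => cosDensity p G (x + (-y : ℝ) * Complex.I)
    have h3 := (periodic_cosDensity (p := p) (G := G) (-y)).intervalIntegral_add_eq
      (-(2 * Real.pi)) 0
    rw [neg_add_cancel, zero_add] at h3
    rw [neg_zero, h3] at h2
    rw [← h2]
    refine intervalIntegral.integral_congr fun x _ => ?_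
    rw [← cosDensity_neg]
    congr 1
    push_cast
    ring
  · simp
  · rw [abs_of_pos hy]
    exact integral_cosDensity_le_of_pos hp hG hy

lemma integral_cosDensity_real (hp : 0 < p) :
    ∫ x in (0 : ℝ)..2 * Real.pi, cosDensity p G x =
      2 * ∫ x in (0 : ℝ)..Real.pi, cosDensity p G x := by
  have hc : Continuous fun x : ℝ => cosDensity p G x :=
    (continuous_cosDensity hp).comp Complex.continuous_ofReal
  have hper : Function.Periodic (fun x : ℝ => cosDensity p G x) (2 * Real.pi) := by
    simpa using periodic_cosDensity (p := p) (G := G) 0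
  have h1 := hper.intervalIntegral_add_eq (-Real.pi) 0
  rw [zero_add, show -Real.pi + 2 * Real.pi = Real.pi by ring] at h1
  rw [← h1, ← intervalIntegral.integral_add_adjacent_intervals (b := 0)
    (hc.intervalIntegrable _ _) (hc.intervalIntegrable _ _), two_mul]
  congr 1
  have h2 := intervalIntegral.integral_comp_neg (a := -Real.pi) (b := 0)
    (fun x : ℝ => cosDensity p G x)
  simp only [neg_zero, neg_neg] at h2
  rw [← h2]
  refine intervalIntegral.integral_congr fun x _ => ?_
  simp only [Complex.ofReal_neg, cosDensity_neg]

/-- Integrals of `cosDensity` over horizontal lines are controlled by the one over `[0, π]`. -/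
lemma lintegral_cosDensity_le {n : ℕ} (hp : 0 < p) (hG : G.natDegree ≤ n) {r y : ℝ}
    (hr : r ≤ Real.pi / 2) (hy : |y| ≤ r) :
    ∫⁻ x in Set.Icc (-r) (Real.pi + r), ENNReal.ofReal (cosDensity p G (x + y * Complex.I)) ≤
      ENNReal.ofReal (2 * Real.exp ((p * n + 1) * r)) *
        ∫⁻ x in Set.Icc 0 Real.pi, ENNReal.ofReal (cosDensity p G x) := by
  have hc : Continuous fun x : ℝ => cosDensity p G (x + y * Complex.I) :=
    (continuous_cosDensity hp).comp (by fun_prop)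
  have hc0 : Continuous fun x : ℝ => cosDensity p G x :=
    (continuous_cosDensity hp).comp Complex.continuous_ofReal
  have key : ∀ (f : ℝ → ℝ) (_ : Continuous f) (_ : ∀ x, 0 ≤ f x) (a b : ℝ) (_ : a ≤ b),
      ∫⁻ x in Set.Icc a b, ENNReal.ofReal (f x) = ENNReal.ofReal (∫ x in a..b, f x) := by
    intro f hf hf0 a b hab
    rw [intervalIntegral.integral_of_le hab, ← integral_Icc_eq_integral_Ioc,
      ofReal_integral_eq_lintegral_ofReal hf.integrableOn_Icc (ae_of_all _ hf0)]
  have hpi := Real.pi_pos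
  calc ∫⁻ x in Set.Icc (-r) (Real.pi + r), ENNReal.ofReal (cosDensity p G (x + y * Complex.I))
      ≤ ∫⁻ x in Set.Icc (-(Real.pi / 2)) (-(Real.pi / 2) + 2 * Real.pi),
          ENNReal.ofReal (cosDensity p G (x + y * Complex.I)) := by
        refine lintegral_mono_set (Set.Icc_subset_Icc ?_ ?_) <;> linarith
    _ = ENNReal.ofReal (∫ x in (0 : ℝ)..2 * Real.pi, cosDensity p G (x + y * Complex.I)) := by
        rw [key _ hc (fun x => cosDensity_nonneg _) _ _ (by linarith),
          (periodic_cosDensity (p := p) (G := G) y).intervalIntegral_add_eq _ 0, zero_add]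
    _ ≤ ENNReal.ofReal (2 * Real.exp ((p * n + 1) * r) *
          ∫ x in (0 : ℝ)..Real.pi, cosDensity p G x) := by
        refine ENNReal.ofReal_le_ofReal ?_
        refine (integral_cosDensity_le hp hG y).trans ?_
        rw [integral_cosDensity_real hp]
        have h0 : 0 ≤ ∫ x in (0 : ℝ)..Real.pi, cosDensity p G x :=
          intervalIntegral.integral_nonneg hpi.le fun x _ => cosDensity_nonneg _
        have : Real.exp ((p * n + 1) * |y|) ≤ Real.exp ((p * n + 1) * r) := by gcongr
        nlinarith
    _ = _ := by
        rw [ENNReal.ofReal_mul (by positivity),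
          key _ hc0 (fun x => cosDensity_nonneg _) _ _ hpi.le]

/-- The area sub-mean value property of `cosDensity`. -/
lemma ofReal_mul_cosDensity_le_lintegral (hp : 0 < p) (c : ℂ) {r : ℝ} (hr : 0 < r) :
    ENNReal.ofReal (Real.pi * r ^ 2) * ENNReal.ofReal (cosDensity p G c) ≤
      ∫⁻ z in Metric.ball c r, ENNReal.ofReal (cosDensity p G z) := by
  have hcont := continuous_cosDensity (G := G) hp
  set F : ℂ → ℝ≥0∞ := fun z => ENNReal.ofReal (cosDensity p G z) with hF
  have hFc : Continuous F := ENNReal.continuous_ofReal.comp hcont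
  have hmean : ∀ s : ℝ, 0 < s → ENNReal.ofReal (2 * Real.pi * cosDensity p G c) ≤
      ∫⁻ t in Set.Ioo (-Real.pi) Real.pi, F (circleMap c s t) := by
    intro s hs
    have h1 := rpow_norm_mul_norm_le_circleAverage (c := c) (R := s) (p := p) hs.ne' hp
      (h := fun z => G.eval (Complex.cos z)) (k := Complex.sin)
      (fun z _ => (differentiable_eval_cos G).analyticAt z)
      (fun z _ => Complex.differentiable_sin.analyticAt z)
    have hper : Function.Periodic (fun t => cosDensity p G (circleMap c s t)) (2 * Real.pi) :=
      fun t => by simp only [periodic_circleMap c s t]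
    have h2 := hper.intervalIntegral_add_eq (-Real.pi) 0
    rw [zero_add, show -Real.pi + 2 * Real.pi = Real.pi by ring] at h2
    have h3 : 2 * Real.pi * cosDensity p G c ≤
        ∫ t in (-Real.pi)..Real.pi, cosDensity p G (circleMap c s t) := by
      rw [h2]
      simp only [Real.circleAverage, smul_eq_mul] at h1
      rw [← div_eq_inv_mul, le_div_iff₀ (by positivity)] at h1
      rw [mul_comm]
      exact h1
    refine (ENNReal.ofReal_le_ofReal h3).trans ?_
    have hcc : Continuous fun t => cosDensity p G (circleMap c s t) :=
      hcont.comp (continuous_circleMap c s)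
    rw [intervalIntegral.integral_of_le (by linarith [Real.pi_pos]), integral_Ioc_eq_integral_Ioo,
      ofReal_integral_eq_lintegral_ofReal
        (hcc.integrableOn_Icc.mono_set Set.Ioo_subset_Icc_self)
        (ae_of_all _ fun t => cosDensity_nonneg _)]
  have hball : ∫⁻ z in Metric.ball c r, F z =
      ∫⁻ z, (Metric.ball (0 : ℂ) r).indicator (fun z => F (c + z)) z := by
    rw [← lintegral_indicator Metric.isOpen_ball.measurableSet,
      ← lintegral_add_left_eq_self _ c]
    congr 1
    ext z
    simp only [Set.indicator]
    congr 1
    simp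
  rw [hball, ← Complex.lintegral_comp_polarCoord_symm]
  have hsub : Set.Ioo (0 : ℝ) r ×ˢ Set.Ioo (-Real.pi) Real.pi ⊆ polarCoord.target := by
    rw [polarCoord_target]
    exact Set.prod_mono Set.Ioo_subset_Ioi_self subset_rfl
  refine le_trans ?_ (lintegral_mono_set hsub)
  have hmeas : MeasurableSet (Set.Ioo (0 : ℝ) r ×ˢ Set.Ioo (-Real.pi) Real.pi) :=
    measurableSet_Ioo.prod measurableSet_Ioo
  have hcongr : ∫⁻ q in Set.Ioo (0 : ℝ) r ×ˢ Set.Ioo (-Real.pi) Real.pi, ENNReal.ofReal q.1 •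
        (Metric.ball (0 : ℂ) r).indicator (fun z => F (c + z)) (Complex.polarCoord.symm q) =
      ∫⁻ q in Set.Ioo (0 : ℝ) r ×ˢ Set.Ioo (-Real.pi) Real.pi,
        ENNReal.ofReal q.1 * F (circleMap c q.1 q.2) := by
    refine setLIntegral_congr_fun hmeas fun q hq => ?_
    have h1 : Complex.polarCoord.symm q ∈ Metric.ball (0 : ℂ) r := by
      rw [mem_ball_zero_iff, Complex.norm_polarCoord_symm, abs_of_pos hq.1.1]
      exact hq.1.2
    simp only [Set.indicator_of_mem h1, smul_eq_mul]
    rw [Complex.polarCoord_symm_apply, circleMap, Complex.exp_mul_I]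
    push_cast
    rfl
  have hFm : Measurable fun q : ℝ × ℝ => ENNReal.ofReal q.1 * F (circleMap c q.1 q.2) := by
    refine Measurable.mul (by fun_prop) (hFc.comp ?_).measurable
    unfold circleMap
    fun_prop
  rw [hcongr, Measure.volume_eq_prod, ← Measure.prod_restrict, lintegral_prod _ hFm.aemeasurable]
  calc ENNReal.ofReal (Real.pi * r ^ 2) * ENNReal.ofReal (cosDensity p G c)
      = ∫⁻ s in Set.Ioo 0 r, ENNReal.ofReal s * ENNReal.ofReal (2 * Real.pi * cosDensity p G c) := by
        rw [lintegral_mul_const _ (by fun_prop)]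
        have : ∫⁻ s in Set.Ioo 0 r, ENNReal.ofReal s = ENNReal.ofReal (r ^ 2 / 2) := by
          have hint : IntegrableOn (fun s : ℝ => s) (Set.Ioo 0 r) :=
            continuous_id'.integrableOn_Icc.mono_set Set.Ioo_subset_Icc_self
          rw [← ofReal_integral_eq_lintegral_ofReal hint
            ((ae_restrict_iff' measurableSet_Ioo).2 (ae_of_all _ fun s hs => hs.1.le)),
            ← integral_Ioc_eq_integral_Ioo, ← intervalIntegral.integral_of_le hr.le]
          simp
        rw [this, ← ENNReal.ofReal_mul (by positivity), ← ENNReal.ofReal_mul (by positivity)]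
        congr 1
        ring
    _ ≤ _ := by
        refine setLIntegral_mono' measurableSet_Ioo fun s hs => ?_
        have hm : Measurable fun t => F (circleMap c s t) :=
          (hFc.comp (continuous_circleMap c s)).measurable
        dsimp only
        rw [lintegral_const_mul _ hm]
        gcongr
        exact hmean s hs.1

end cosDensity

/-- A set meeting every interval of length `2 * r` in a set of measure at most `δ` carries
only a small part of the integral of `cosDensity`. -/
lemma mul_lintegral_cosDensity_le {p : ℝ} {G : Polynomial ℂ} {n : ℕ} (hp : 0 < p)
    (hG : G.natDegree ≤ n) {r δ : ℝ} (hr : 0 < r) (hr' : r ≤ Real.pi / 2)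
    {A : Set ℝ} (hA : MeasurableSet A) (hsub : A ⊆ Set.Icc 0 Real.pi)
    (hδ : ∀ a : ℝ, volume (A ∩ Set.Icc (a - r) (a + r)) ≤ ENNReal.ofReal δ) :
    ENNReal.ofReal (Real.pi * r ^ 2) * ∫⁻ t in A, ENNReal.ofReal (cosDensity p G t) ≤
      ENNReal.ofReal δ * ENNReal.ofReal (2 * r) * ENNReal.ofReal (2 * Real.exp ((p * n + 1) * r)) *
        ∫⁻ t in Set.Icc 0 Real.pi, ENNReal.ofReal (cosDensity p G t) := by
  set F : ℂ → ℝ≥0∞ := fun z => ENNReal.ofReal (cosDensity p G z) with hF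
  have hFc : Continuous F := ENNReal.continuous_ofReal.comp (continuous_cosDensity hp)
  set S : Set ℂ := Set.Icc (-r) (Real.pi + r) ×ℂ Set.Icc (-r) r with hS
  have hSm : MeasurableSet S :=
    (measurableSet_Icc.preimage Complex.measurable_re).inter
      (measurableSet_Icc.preimage Complex.measurable_im)
  have hind : Measurable (Function.uncurry fun (t : ℝ) (z : ℂ) =>
      (Metric.ball (t : ℂ) r).indicator F z) := by
    have : (Function.uncurry fun (t : ℝ) (z : ℂ) => (Metric.ball (t : ℂ) r).indicator F z) =
        {q : ℝ × ℂ | dist q.2 (q.1 : ℂ) < r}.indicator fun q => F q.2 := by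
      ext q
      simp [Function.uncurry, Set.indicator, Metric.mem_ball]
    rw [this]
    refine (hFc.measurable.comp measurable_snd).indicator (IsOpen.measurableSet ?_)
    exact isOpen_lt (by fun_prop) continuous_const
  have hpt : ∀ z : ℂ, ∫⁻ t in A, (Metric.ball (t : ℂ) r).indicator F z ≤
      S.indicator (fun z => ENNReal.ofReal δ * F z) z := by
    intro z
    have hle : ∀ t : ℝ, z ∈ Metric.ball (t : ℂ) r → |z.re - t| < r ∧ |z.im| < r := by
      intro t ht
      rw [Metric.mem_ball, dist_eq_norm] at ht
      have h1 := Complex.abs_re_le_norm (z - t)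
      have h2 := Complex.abs_im_le_norm (z - t)
      simp only [Complex.sub_re, Complex.sub_im, Complex.ofReal_re, Complex.ofReal_im,
        sub_zero] at h1 h2
      exact ⟨h1.trans_lt ht, h2.trans_lt ht⟩
    by_cases hz : z ∈ S
    · rw [Set.indicator_of_mem hz]
      calc ∫⁻ t in A, (Metric.ball (t : ℂ) r).indicator F z
          ≤ ∫⁻ t in A, (Set.Icc (z.re - r) (z.re + r)).indicator (fun _ => F z) t := by
            refine lintegral_mono fun t => ?_
            by_cases ht : z ∈ Metric.ball (t : ℂ) r
            · have h := abs_lt.1 (hle t ht).1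
              rw [Set.indicator_of_mem ht, Set.indicator_of_mem]
              constructor <;> linarith
            · rw [Set.indicator_of_notMem ht]
              exact zero_le
        _ = F z * volume (A ∩ Set.Icc (z.re - r) (z.re + r)) := by
            rw [lintegral_indicator_const measurableSet_Icc, Measure.restrict_apply
              measurableSet_Icc, Set.inter_comm]
        _ ≤ ENNReal.ofReal δ * F z := by
            rw [mul_comm]
            gcongr
            exact hδ _
    · rw [Set.indicator_of_notMem hz, nonpos_iff_eq_zero]
      refine setLIntegral_eq_zero hA fun t ht => ?_
      refine Set.indicator_of_notMem (fun h => hz ?_) _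
      have h1 := abs_lt.1 (hle t h).1
      have h2 := abs_lt.1 (hle t h).2
      have h3 := hsub ht
      rw [hS, Complex.mem_reProdIm]
      refine ⟨⟨?_, ?_⟩, ?_, ?_⟩ <;> linarith [h3.1, h3.2]
  have hSint : ∫⁻ z in S, F z ≤ ENNReal.ofReal (2 * r) *
      (ENNReal.ofReal (2 * Real.exp ((p * n + 1) * r)) *
        ∫⁻ t in Set.Icc 0 Real.pi, F t) := by
    have hmp := Complex.volume_preserving_equiv_real_prod.symm
    rw [← hmp.setLIntegral_comp_preimage hSm hFc.measurable]
    have hpre : Complex.measurableEquivRealProd.symm ⁻¹' S =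
        Set.Icc (-r) (Real.pi + r) ×ˢ Set.Icc (-r) r := by
      ext q
      simp [hS, Complex.mem_reProdIm, Complex.measurableEquivRealProd, -Set.Icc_prod_Icc]
    have hm : Measurable fun q => F (Complex.measurableEquivRealProd.symm q) :=
      hFc.measurable.comp hmp.measurable
    rw [hpre, Measure.volume_eq_prod, ← Measure.prod_restrict,
      lintegral_prod_symm _ hm.aemeasurable]
    calc _ ≤ ∫⁻ y in Set.Icc (-r) r, ENNReal.ofReal (2 * Real.exp ((p * n + 1) * r)) *
            ∫⁻ t in Set.Icc 0 Real.pi, F t := by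
          refine setLIntegral_mono' measurableSet_Icc fun y hy => ?_
          have hxy : ∀ x : ℝ, Complex.measurableEquivRealProd.symm (x, y) = x + y * Complex.I :=
            fun x => Complex.mk_eq_add_mul_I x y
          simp_rw [hxy]
          exact lintegral_cosDensity_le hp hG hr' (abs_le.2 hy)
      _ = _ := by
          rw [lintegral_const, Measure.restrict_apply MeasurableSet.univ, Set.univ_inter,
            Real.volume_Icc, mul_comm]
          congr 2
          ring
  calc ENNReal.ofReal (Real.pi * r ^ 2) * ∫⁻ t in A, F t
      = ∫⁻ t : ℝ in A, ENNReal.ofReal (Real.pi * r ^ 2) * F t := by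
        rw [lintegral_const_mul]
        exact (hFc.comp Complex.continuous_ofReal).measurable
    _ ≤ ∫⁻ t : ℝ in A, ∫⁻ z, (Metric.ball (t : ℂ) r).indicator F z := by
        refine lintegral_mono fun t => ?_
        rw [lintegral_indicator Metric.isOpen_ball.measurableSet]
        exact ofReal_mul_cosDensity_le_lintegral hp _ hr
    _ = ∫⁻ z, ∫⁻ t in A, (Metric.ball (t : ℂ) r).indicator F z :=
        lintegral_lintegral_swap hind.aemeasurable
    _ ≤ ∫⁻ z, S.indicator (fun z => ENNReal.ofReal δ * F z) z := lintegral_mono hpt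
    _ = ENNReal.ofReal δ * ∫⁻ z in S, F z := by
        rw [lintegral_indicator hSm, lintegral_const_mul _ hFc.measurable]
    _ ≤ _ := by
        rw [mul_assoc, mul_assoc]
        gcongr

/-- The complex polynomial `w ↦ g (R * w)`. -/
def complexRescale (R : ℝ) (g : Polynomial ℝ) : Polynomial ℂ :=
  (g.map Complex.ofRealHom).comp (Polynomial.C (R : ℂ) * Polynomial.X)

lemma natDegree_complexRescale_le (R : ℝ) (g : Polynomial ℝ) :
    (complexRescale R g).natDegree ≤ g.natDegree := by
  refine Polynomial.natDegree_comp_le.trans ?_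
  calc (g.map Complex.ofRealHom).natDegree * (Polynomial.C (R : ℂ) * Polynomial.X).natDegree
      ≤ g.natDegree * 1 :=
        Nat.mul_le_mul Polynomial.natDegree_map_le 
          ((Polynomial.natDegree_C_mul_le _ _).trans Polynomial.natDegree_X_le)
    _ = g.natDegree := mul_one _

lemma eval_complexRescale (R : ℝ) (g : Polynomial ℝ) (t : ℝ) :
    (complexRescale R g).eval (Complex.cos t) = (g.eval (R * Real.cos t) : ℝ) := by
  rw [complexRescale, Polynomial.eval_comp]
  simp only [Polynomial.eval_mul, Polynomial.eval_C, Polynomial.eval_X]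
  rw [← Complex.ofReal_cos, ← Complex.ofReal_mul]
  exact Polynomial.eval_map_apply (f := Complex.ofRealHom) (p := g) (R * Real.cos t)

/-- The change of variables `s = R cos t` on `[-R, R]`. -/
lemma lintegral_inter_Icc_eq_lintegral_cosDensity {p R : ℝ} (hp : 0 < p) (hR : 0 < R)
    (g : Polynomial ℝ) {B : Set ℝ} (hB : MeasurableSet B) :
    ∫⁻ s in B ∩ Set.Icc (-R) R, ‖g.eval s‖ₑ ^ p = ENNReal.ofReal R *
      ∫⁻ t in Set.Icc 0 Real.pi ∩ (fun t => R * Real.cos t) ⁻¹' B,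
        ENNReal.ofReal (cosDensity p (complexRescale R g) t) := by
  have hm : Measurable fun t : ℝ => ENNReal.ofReal (cosDensity p (complexRescale R g) t) :=
    ENNReal.measurable_ofReal.comp
      ((continuous_cosDensity hp).comp Complex.continuous_ofReal).measurable
  set A : Set ℝ := Set.Icc 0 Real.pi ∩ (fun t => R * Real.cos t) ⁻¹' B with hA
  have hAm : MeasurableSet A := measurableSet_Icc.inter (hB.preimage (by fun_prop))
  have himage : (fun t => R * Real.cos t) '' A = B ∩ Set.Icc (-R) R := by
    rw [hA, Set.image_inter_preimage, Set.inter_comm]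
    congr 1
    rw [← Set.image_image (fun s => R * s) Real.cos, Real.bijOn_cos.image_eq,
      Set.image_mul_left_Icc hR.le (by norm_num)]
    simp
  rw [← himage, lintegral_image_eq_lintegral_abs_deriv_mul (f' := fun t => R * -Real.sin t) hAm
    (fun t _ => ((Real.hasDerivAt_cos t).const_mul R).hasDerivWithinAt)
    (fun t ht u hu h => Real.injOn_cos ht.1 hu.1 (mul_left_cancel₀ hR.ne' h)),
    ← lintegral_const_mul _ hm]
  refine lintegral_congr fun t => ?_
  rw [cosDensity, eval_complexRescale, Complex.norm_real, ← Complex.ofReal_sin, Complex.norm_real,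
    mul_neg, abs_neg, abs_mul, abs_of_pos hR, ENNReal.ofReal_mul hR.le,
    ENNReal.ofReal_mul (by positivity), ← ENNReal.ofReal_rpow_of_nonneg (norm_nonneg _) hp.le,
    ofReal_norm, ← Real.norm_eq_abs]
  ring

lemma two_mul_abs_le_pi_mul_abs_add {x y : ℝ} (h : |x - y| ≤ Real.pi) :
    2 * |x - y| ≤ Real.pi * (|Real.cos x - Real.cos y| + |Real.sin x - Real.sin y|) := by
  have h1 := Real.cos_le_one_sub_mul_cos_sq h
  have h2 : (Real.cos x - Real.cos y) ^ 2 + (Real.sin x - Real.sin y) ^ 2 =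
      2 - 2 * Real.cos (x - y) := by
    rw [Real.cos_sub]
    linear_combination Real.sin_sq_add_cos_sq x + Real.sin_sq_add_cos_sq y
  have hpi := Real.pi_pos
  have h3 : (2 * |x - y|) ^ 2 ≤
      (Real.pi * (|Real.cos x - Real.cos y| + |Real.sin x - Real.sin y|)) ^ 2 := by
    rw [mul_pow, mul_pow, sq_abs]
    have h4 : 4 * (x - y) ^ 2 ≤ Real.pi ^ 2 * (2 - 2 * Real.cos (x - y)) := by
      have : Real.pi ^ 2 * (2 / Real.pi ^ 2 * (x - y) ^ 2) = 2 * (x - y) ^ 2 := by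
        field_simp
      nlinarith [mul_le_mul_of_nonneg_left h1 (sq_nonneg Real.pi)]
    have h5 : 2 - 2 * Real.cos (x - y) ≤
        (|Real.cos x - Real.cos y| + |Real.sin x - Real.sin y|) ^ 2 := by
      rw [← h2, add_sq, sq_abs, sq_abs]
      have := mul_nonneg (abs_nonneg (Real.cos x - Real.cos y))
        (abs_nonneg (Real.sin x - Real.sin y))
      linarith
    nlinarith [mul_le_mul_of_nonneg_left h5 (sq_nonneg Real.pi)]
  exact le_of_sq_le_sq h3 (by positivity)

section rhoB

variable {d : ℕ}

lemma rhoB_comm (x y : EuclideanSpace ℝ (Fin (d + 1))) : rhoB x y = rhoB y x := by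
  rw [rhoB, rhoB, norm_sub_rev, abs_sub_comm]

lemma rhoB_triangle (x y z : EuclideanSpace ℝ (Fin (d + 1))) :
    rhoB x z ≤ rhoB x y + rhoB y z := by
  have h1 := norm_sub_le_norm_sub_add_norm_sub x y z
  have h2 := abs_sub_le √(1 - ‖x‖ ^ 2) √(1 - ‖y‖ ^ 2) √(1 - ‖z‖ ^ 2)
  simp only [rhoB]
  linarith

lemma continuous_rhoB_right (x : EuclideanSpace ℝ (Fin (d + 1))) :
    Continuous fun y => rhoB x y := by
  unfold rhoB
  fun_prop

/-- The union of the `ρ`-balls of radius `δ` about the points `ξ i`. -/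
def rhoBallUnion {m : ℕ} (ξ : Fin m → EuclideanSpace ℝ (Fin (d + 1))) (δ : ℝ) :
    Set (EuclideanSpace ℝ (Fin (d + 1))) :=
  ⋃ i : Fin m, {η | ‖η‖ ≤ 1 ∧ rhoB (ξ i) η ≤ δ}

lemma isClosed_rhoBallUnion {m : ℕ} (ξ : Fin m → EuclideanSpace ℝ (Fin (d + 1))) (δ : ℝ) :
    IsClosed (rhoBallUnion ξ δ) :=
  isClosed_iUnion_of_finite fun i => (isClosed_le continuous_norm continuous_const).inter
    (isClosed_le (continuous_rhoB_right (ξ i)) continuous_const)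

lemma norm_le_one_of_mem_rhoBallUnion {m : ℕ} {ξ : Fin m → EuclideanSpace ℝ (Fin (d + 1))} {δ : ℝ}
    {x : EuclideanSpace ℝ (Fin (d + 1))} (hx : x ∈ rhoBallUnion ξ δ) : ‖x‖ ≤ 1 := by
  obtain ⟨i, hi⟩ := Set.mem_iUnion.1 hx
  exact hi.1

/-- Two nearby points of a union of small, well separated `ρ`-balls lie in the same ball. -/
lemma rhoB_le_of_mem_rhoBallUnion {m : ℕ} {ξ : Fin m → EuclideanSpace ℝ (Fin (d + 1))} {σ δ : ℝ}
    (hξ : ∀ i j, i ≠ j → σ ≤ rhoB (ξ i) (ξ j)) {x y : EuclideanSpace ℝ (Fin (d + 1))}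
    (hx : x ∈ rhoBallUnion ξ δ) (hy : y ∈ rhoBallUnion ξ δ) (hxy : rhoB x y < σ - 2 * δ) :
    rhoB x y ≤ 2 * δ := by
  obtain ⟨i, -, hi⟩ := Set.mem_iUnion.1 hx
  obtain ⟨j, -, hj⟩ := Set.mem_iUnion.1 hy
  rcases eq_or_ne i j with rfl | hij
  · have := rhoB_triangle x (ξ i) y
    rw [rhoB_comm x (ξ i)] at this
    linarith
  · have h1 := hξ i j hij
    have h2 := rhoB_triangle (ξ i) x (ξ j)
    have h3 := rhoB_triangle x y (ξ j)
    rw [rhoB_comm y] at h3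
    linarith

/-- The point whose `i`-th coordinate is `s` and whose other coordinates are given by `z`. -/
def chordPoint (i : Fin (d + 1)) (s : ℝ) (z : Fin d → ℝ) : EuclideanSpace ℝ (Fin (d + 1)) :=
  WithLp.toLp 2 (i.insertNth s z)

lemma chordPoint_apply_same (i : Fin (d + 1)) (s : ℝ) (z : Fin d → ℝ) :
    chordPoint i s z i = s := by
  simp [chordPoint]

lemma chordPoint_removeNth (i : Fin (d + 1)) (x : EuclideanSpace ℝ (Fin (d + 1))) :
    chordPoint i (x i) (fun k => x (i.succAbove k)) = x := by
  ext j
  exact congrFun (Fin.insertNth_self_removeNth i (fun j => x j)) j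

lemma norm_chordPoint_sq (i : Fin (d + 1)) (s : ℝ) (z : Fin d → ℝ) :
    ‖chordPoint i s z‖ ^ 2 = s ^ 2 + ∑ k, z k ^ 2 := by
  rw [EuclideanSpace.real_norm_sq_eq, Fin.sum_univ_succAbove _ i]
  simp [chordPoint]

lemma norm_chordPoint_sub (i : Fin (d + 1)) (s s' : ℝ) (z : Fin d → ℝ) :
    ‖chordPoint i s z - chordPoint i s' z‖ = |s - s'| := by
  rw [← sq_eq_sq₀ (norm_nonneg _) (abs_nonneg _), sq_abs,
    EuclideanSpace.real_norm_sq_eq, Fin.sum_univ_succAbove _ i]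
  simp [chordPoint]

lemma rhoB_chordPoint {i : Fin (d + 1)} {z : Fin d → ℝ} {R : ℝ} (hR : 0 ≤ R)
    (hz : R ^ 2 = 1 - ∑ k, z k ^ 2) {t u : ℝ} (ht : t ∈ Set.Icc 0 Real.pi)
    (hu : u ∈ Set.Icc 0 Real.pi) :
    rhoB (chordPoint i (R * Real.cos t) z) (chordPoint i (R * Real.cos u) z) =
      R * (|Real.cos t - Real.cos u| + |Real.sin t - Real.sin u|) := by
  have key : ∀ v ∈ Set.Icc 0 Real.pi,
      √(1 - ‖chordPoint i (R * Real.cos v) z‖ ^ 2) = R * Real.sin v := by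
    intro v hv
    rw [norm_chordPoint_sq, ← Real.sqrt_sq (mul_nonneg hR (Real.sin_nonneg_of_mem_Icc hv))]
    congr 1
    linear_combination -hz - R ^ 2 * Real.sin_sq_add_cos_sq v
  rw [rhoB, key t ht, key u hu, norm_chordPoint_sub, ← mul_sub, ← mul_sub, abs_mul, abs_mul,
    abs_of_nonneg hR, mul_add]

/-- Some coordinate chord through a given point of the unit ball is long. -/
lemma exists_one_div_le_chord (x : EuclideanSpace ℝ (Fin (d + 1))) (hx : ‖x‖ ≤ 1) :
    ∃ i, 1 / ((d : ℝ) + 1) ≤ 1 - ‖x‖ ^ 2 + x i ^ 2 := by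
  by_contra! h
  have h1 : ∑ i, (1 - ‖x‖ ^ 2 + x i ^ 2) < ∑ _i : Fin (d + 1), 1 / ((d : ℝ) + 1) :=
    Finset.sum_lt_sum_of_nonempty Finset.univ_nonempty fun i _ => h i
  rw [Finset.sum_add_distrib, ← EuclideanSpace.real_norm_sq_eq] at h1
  simp only [Finset.sum_const, Finset.card_univ, Fintype.card_fin, nsmul_eq_mul] at h1
  push_cast at h1
  rw [mul_one_div_cancel (by positivity)] at h1
  have h2 : 0 ≤ 1 - ‖x‖ ^ 2 := by nlinarith [norm_nonneg x]
  nlinarith [mul_nonneg (Nat.cast_nonneg (α := ℝ) d) h2]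

/-- Along a long chord parametrised by `t ↦ R cos t`, the points of a union of small well
separated `ρ`-balls come in clusters of small diameter. -/
lemma abs_sub_le_of_mem_rhoBallUnion {m n : ℕ} {ξ : Fin m → EuclideanSpace ℝ (Fin (d + 1))}
    (hn : 0 < n) (hξ : ∀ i j, i ≠ j → 1 / (n : ℝ) ≤ rhoB (ξ i) (ξ j)) {ε : ℝ} (hε : ε < 1 / 4)
    {i : Fin (d + 1)} {z : Fin d → ℝ} {R : ℝ} (hR : 0 ≤ R) (hz : R ^ 2 = 1 - ∑ k, z k ^ 2)
    (hRd : 1 / ((d : ℝ) + 1) ≤ R ^ 2) {t u : ℝ} (ht : t ∈ Set.Icc 0 Real.pi)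
    (hu : u ∈ Set.Icc 0 Real.pi)
    (htE : chordPoint i (R * Real.cos t) z ∈ rhoBallUnion ξ (ε / n))
    (huE : chordPoint i (R * Real.cos u) z ∈ rhoBallUnion ξ (ε / n))
    (htu : |t - u| ≤ 1 / (4 * n)) : |t - u| ≤ Real.pi * ((d : ℝ) + 1) * ε / n := by
  have hn' : (0 : ℝ) < n := by exact_mod_cast hn
  have hR1 : R ≤ 1 := by
    have : 0 ≤ ∑ k, z k ^ 2 := Finset.sum_nonneg fun k _ => sq_nonneg _
    nlinarith
  have hcos := Real.abs_cos_sub_cos_le t u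
  have hsin := Real.abs_sin_sub_sin_le t u
  have hrho := rhoB_chordPoint (i := i) hR hz ht hu
  set S := |Real.cos t - Real.cos u| + |Real.sin t - Real.sin u| with hS
  have hS0 : 0 ≤ S := by positivity
  have h1 : rhoB (chordPoint i (R * Real.cos t) z) (chordPoint i (R * Real.cos u) z) ≤
      2 * ε / n := by
    rw [mul_div_assoc]
    refine rhoB_le_of_mem_rhoBallUnion hξ htE huE ?_
    have h2 : R * S ≤ 1 / (2 * n) := by
      calc R * S ≤ 1 * S := by gcongr
        _ ≤ 2 * (1 / (4 * n)) := by linarith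
        _ = 1 / (2 * n) := by field_simp; norm_num
    have h3 : 1 / (2 * (n : ℝ)) < 1 / n - 2 * (ε / n) := by
      rw [show 1 / (n : ℝ) - 2 * (ε / n) = (1 - 2 * ε) / n by ring,
        show 1 / (2 * (n : ℝ)) = (1 / 2) / n by field_simp]
      gcongr
      linarith
    rw [hrho]
    linarith
  rw [hrho] at h1
  have h4 : 1 ≤ ((d : ℝ) + 1) * R := by
    have : 1 ≤ ((d : ℝ) + 1) * R ^ 2 := by
      rwa [div_le_iff₀' (by positivity)] at hRd
    have hd : (0 : ℝ) ≤ d + 1 := by positivity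
    nlinarith [mul_le_mul_of_nonneg_left (show R ^ 2 ≤ R by nlinarith) hd]
  have h5 : 2 * |t - u| ≤ Real.pi * S := by
    refine two_mul_abs_le_pi_mul_abs_add ?_
    rw [abs_le]
    constructor <;> linarith [ht.1, ht.2, hu.1, hu.2]
  have h6 : S ≤ ((d : ℝ) + 1) * (2 * ε / n) := by
    calc S ≤ (((d : ℝ) + 1) * R) * S := le_mul_of_one_le_left hS0 h4
      _ = ((d : ℝ) + 1) * (R * S) := by ring
      _ ≤ _ := by gcongr
  have h7 := mul_le_mul_of_nonneg_left h6 Real.pi_pos.le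
  have h8 : Real.pi * ((d : ℝ) + 1) * ε / n = Real.pi * (((d : ℝ) + 1) * (2 * ε / n)) / 2 := by
    ring
  rw [h8]
  linarith

end rhoB

section chord

variable {d : ℕ}

lemma measurable_chordPoint (i : Fin (d + 1)) :
    Measurable fun q : ℝ × (Fin d → ℝ) => chordPoint i q.1 q.2 :=
  (PiLp.volume_preserving_toLp (Fin (d + 1))).measurable.comp
    (MeasurableEquiv.piFinSuccAbove (fun _ : Fin (d + 1) => ℝ) i).symm.measurable

/-- Integration along the chords in the `i`-th coordinate direction. -/
lemma lintegral_eq_lintegral_chordPoint (i : Fin (d + 1))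
    {h : EuclideanSpace ℝ (Fin (d + 1)) → ℝ≥0∞} (hh : Measurable h) :
    ∫⁻ x, h x = ∫⁻ z, ∫⁻ s, h (chordPoint i s z) := by
  have h1 := (PiLp.volume_preserving_toLp (Fin (d + 1))).lintegral_comp hh
  have h2 := (volume_preserving_piFinSuccAbove (fun _ : Fin (d + 1) => ℝ) i).symm.lintegral_comp
    (hh.comp (PiLp.volume_preserving_toLp (Fin (d + 1))).measurable)
  rw [← h1]
  refine h2.symm.trans ?_
  rw [Measure.volume_eq_prod]
  exact lintegral_prod_symm _ (hh.comp (measurable_chordPoint i)).aemeasurable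

/-- The restriction of a polynomial in `d + 1` variables to a chord. -/
def chordPolynomial (P : MvPolynomial (Fin (d + 1)) ℝ) (i : Fin (d + 1)) (z : Fin d → ℝ) :
    Polynomial ℝ :=
  MvPolynomial.aeval
    (i.insertNth (α := fun _ => Polynomial ℝ) Polynomial.X fun k => Polynomial.C (z k)) P

lemma natDegree_chordPolynomial_le (P : MvPolynomial (Fin (d + 1)) ℝ) (i : Fin (d + 1))
    (z : Fin d → ℝ) : (chordPolynomial P i z).natDegree ≤ P.totalDegree := by
  refine (MvPolynomial.aeval_natDegree_le (n := 1) P le_rfl _ fun j => ?_).trans (mul_one _).le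
  induction j using Fin.succAboveCases i with
  | x => simp
  | p k => simp

lemma eval_chordPolynomial (P : MvPolynomial (Fin (d + 1)) ℝ) (i : Fin (d + 1)) (z : Fin d → ℝ)
    (s : ℝ) : (chordPolynomial P i z).eval s =
      MvPolynomial.eval (fun j => chordPoint i s z j) P := by
  rw [chordPolynomial, ← Polynomial.coe_evalRingHom, MvPolynomial.aeval_def,
    MvPolynomial.eval₂_comp_left, MvPolynomial.eval]
  change _ = MvPolynomial.eval₂ _ _ P
  congr 1
  · ext r
    simp
  · funext j
    induction j using Fin.succAboveCases i with
    | x => simp [chordPoint]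
    | p k => simp [chordPoint]

/-- A union of small, well separated `ρ`-balls carries only a small part of the `L ^ p` norm of
a polynomial along a long chord. -/
lemma mul_setLIntegral_chordPolynomial_le {p : ℝ} (hp : 0 < p) {m n : ℕ}
    {ξ : Fin m → EuclideanSpace ℝ (Fin (d + 1))} (hn : 0 < n)
    (hξ : ∀ i j, i ≠ j → 1 / (n : ℝ) ≤ rhoB (ξ i) (ξ j)) {ε : ℝ} (hε0 : 0 < ε) (hε : ε < 1 / 4)
    {i : Fin (d + 1)} {z : Fin d → ℝ} {R : ℝ} (hR : 0 < R) (hz : R ^ 2 = 1 - ∑ k, z k ^ 2)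
    (hRd : 1 / ((d : ℝ) + 1) ≤ R ^ 2) {g : Polynomial ℝ} (hg : g.natDegree ≤ n) :
    ∫⁻ s in {s | chordPoint i s z ∈ rhoBallUnion ξ (ε / n)} ∩ Set.Icc (-R) R,
        ‖g.eval s‖ₑ ^ p ≤
      ENNReal.ofReal (32 * ((d : ℝ) + 1) * ε * Real.exp (p + 1)) *
        ∫⁻ s in Set.Icc (-R) R, ‖g.eval s‖ₑ ^ p := by
  have hn' : (0 : ℝ) < n := by exact_mod_cast hn
  have hn1 : (1 : ℝ) ≤ n := by exact_mod_cast hn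
  set E : Set ℝ := {s | chordPoint i s z ∈ rhoBallUnion ξ (ε / n)} with hE
  have hEm : MeasurableSet E := (isClosed_rhoBallUnion ξ (ε / n)).measurableSet.preimage
    ((measurable_chordPoint i).comp (measurable_id.prodMk measurable_const))
  set A : Set ℝ := Set.Icc 0 Real.pi ∩ (fun t => R * Real.cos t) ⁻¹' E with hA
  have hAm : MeasurableSet A := measurableSet_Icc.inter (hEm.preimage (by fun_prop))
  set r : ℝ := 1 / (8 * n) with hr
  have hr0 : 0 < r := by positivity
  have hr1 : r ≤ 1 / 8 := by
    rw [hr]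
    gcongr
    linarith
  have hpi := Real.pi_gt_three
  set δ : ℝ := Real.pi * ((d : ℝ) + 1) * ε / n with hδ
  have hvol : ∀ a : ℝ, volume (A ∩ Set.Icc (a - r) (a + r)) ≤ ENNReal.ofReal δ := by
    intro a
    refine (Real.volume_le_diam _).trans (Metric.ediam_le fun t ht u hu => ?_)
    rw [edist_dist, Real.dist_eq]
    refine ENNReal.ofReal_le_ofReal (abs_sub_le_of_mem_rhoBallUnion hn hξ hε hR.le hz hRd
      ht.1.1 hu.1.1 ht.1.2 hu.1.2 ?_)
    have h1 : 1 / (4 * (n : ℝ)) = 2 * r := by rw [hr]; field_simp; norm_num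
    rw [h1, abs_le]
    constructor <;> linarith [ht.2.1, ht.2.2, hu.2.1, hu.2.2]
  have key := mul_lintegral_cosDensity_le hp
    ((natDegree_complexRescale_le R g).trans hg) hr0 (by linarith) hAm Set.inter_subset_left hvol
  have hI := lintegral_inter_Icc_eq_lintegral_cosDensity hp hR g hEm
  have hI' := lintegral_inter_Icc_eq_lintegral_cosDensity hp hR g MeasurableSet.univ
  rw [Set.univ_inter, Set.preimage_univ, Set.inter_univ] at hI'
  rw [hI, hI', mul_left_comm]
  gcongr
  have hc0 : ENNReal.ofReal (Real.pi * r ^ 2) ≠ 0 := by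
    rw [Ne, ENNReal.ofReal_eq_zero, not_le]
    positivity
  refine (ENNReal.mul_le_mul_iff_right hc0 ENNReal.ofReal_ne_top).1 (key.trans ?_)
  rw [← mul_assoc, ← ENNReal.ofReal_mul (by positivity), ← ENNReal.ofReal_mul (by positivity),
    ← ENNReal.ofReal_mul (by positivity)]
  refine mul_le_mul_of_nonneg_right (ENNReal.ofReal_le_ofReal ?_) zero_le
  have hexp : Real.exp ((p * n + 1) * r) ≤ Real.exp (p + 1) := by
    rw [Real.exp_le_exp]
    have : p * n * r = p / 8 := by rw [hr]; field_simp
    rw [add_mul, this]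
    linarith
  have : Real.pi * r ^ 2 * (32 * ((d : ℝ) + 1) * ε * Real.exp (p + 1)) =
      δ * (2 * r) * (2 * Real.exp (p + 1)) := by
    rw [hδ, hr]
    field_simp
    norm_num
  rw [this]
  gcongr

end chord

section ball

variable {d : ℕ}

lemma continuous_eval_coord (P : MvPolynomial (Fin (d + 1)) ℝ) :
    Continuous fun x : EuclideanSpace ℝ (Fin (d + 1)) => MvPolynomial.eval (fun i => x i) P :=
  (MvPolynomial.continuous_eval P).comp (by fun_prop)

/-- The points of the space lying on a long chord in the `i`-th coordinate direction. -/
def longChords (i : Fin (d + 1)) : Set (EuclideanSpace ℝ (Fin (d + 1))) :=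
  {x | 1 / ((d : ℝ) + 1) ≤ 1 - ‖x‖ ^ 2 + x i ^ 2}

lemma measurableSet_longChords (i : Fin (d + 1)) : MeasurableSet (longChords i) :=
  (isClosed_le continuous_const (by fun_prop)).measurableSet

lemma chordPoint_mem_longChords {i : Fin (d + 1)} {s : ℝ} {z : Fin d → ℝ} :
    chordPoint i s z ∈ longChords i ↔ 1 / ((d : ℝ) + 1) ≤ 1 - ∑ k, z k ^ 2 := by
  rw [longChords, Set.mem_ofPred_eq, norm_chordPoint_sq, chordPoint_apply_same]
  ring_nf

lemma setLIntegral_inter_longChords_le {p : ℝ} (hp : 0 < p) {m n : ℕ}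
    {ξ : Fin m → EuclideanSpace ℝ (Fin (d + 1))} (hn : 0 < n)
    (hξ : ∀ i j, i ≠ j → 1 / (n : ℝ) ≤ rhoB (ξ i) (ξ j)) {ε : ℝ} (hε0 : 0 < ε) (hε : ε < 1 / 4)
    {P : MvPolynomial (Fin (d + 1)) ℝ} (hP : P.totalDegree ≤ n) (i : Fin (d + 1)) :
    ∫⁻ x in rhoBallUnion ξ (ε / n) ∩ longChords i, ‖MvPolynomial.eval (fun i => x i) P‖ₑ ^ p ≤
      ENNReal.ofReal (32 * ((d : ℝ) + 1) * ε * Real.exp (p + 1)) *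
        ∫⁻ x in Metric.closedBall (0 : EuclideanSpace ℝ (Fin (d + 1))) 1,
          ‖MvPolynomial.eval (fun i => x i) P‖ₑ ^ p := by
  set F : EuclideanSpace ℝ (Fin (d + 1)) → ℝ≥0∞ :=
    fun x => ‖MvPolynomial.eval (fun i => x i) P‖ₑ ^ p with hF
  have hFm : Measurable F := (continuous_eval_coord P).measurable.enorm.pow_const p
  have hEm := (isClosed_rhoBallUnion ξ (ε / n)).measurableSet
  have hEG := hEm.inter (measurableSet_longChords i)
  have hBm : MeasurableSet (Metric.closedBall (0 : EuclideanSpace ℝ (Fin (d + 1))) 1) :=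
    Metric.isClosed_closedBall.measurableSet
  rw [← lintegral_indicator hEG, ← lintegral_indicator hBm,
    lintegral_eq_lintegral_chordPoint i (hFm.indicator hEG),
    lintegral_eq_lintegral_chordPoint i (hFm.indicator hBm),
    ← lintegral_const_mul' _ _ ENNReal.ofReal_ne_top]
  refine lintegral_mono fun z => ?_
  by_cases hz : 1 / ((d : ℝ) + 1) ≤ 1 - ∑ k, z k ^ 2
  · have hd : 0 < 1 / ((d : ℝ) + 1) := by positivity
    set R : ℝ := √(1 - ∑ k, z k ^ 2) with hR
    have hR0 : 0 < R := Real.sqrt_pos.2 (hd.trans_le hz)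
    have hR2 : R ^ 2 = 1 - ∑ k, z k ^ 2 := Real.sq_sqrt (hd.trans_le hz).le
    have hball : ∀ s : ℝ, ‖chordPoint i s z‖ ≤ 1 ↔ s ∈ Set.Icc (-R) R := by
      intro s
      rw [Set.mem_Icc, ← abs_le, ← sq_le_sq₀ (abs_nonneg s) hR0.le, sq_abs, hR2,
        ← sq_le_sq₀ (norm_nonneg _) zero_le_one, norm_chordPoint_sq, one_pow]
      constructor <;> intro h <;> linarith
    have hEs : MeasurableSet {s | chordPoint i s z ∈ rhoBallUnion ξ (ε / n)} :=
      hEm.preimage ((measurable_chordPoint i).comp (measurable_id.prodMk measurable_const))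
    have hg : (chordPolynomial P i z).natDegree ≤ n :=
      (natDegree_chordPolynomial_le P i z).trans hP
    have h1 := mul_setLIntegral_chordPolynomial_le hp hn hξ hε0 hε (i := i) hR0 hR2
      (hR2 ▸ hz) hg
    rw [← lintegral_indicator (hEs.inter measurableSet_Icc),
      ← lintegral_indicator measurableSet_Icc] at h1
    have e1 : ∀ s, (rhoBallUnion ξ (ε / n) ∩ longChords i).indicator F (chordPoint i s z) =
        ({s | chordPoint i s z ∈ rhoBallUnion ξ (ε / n)} ∩ Set.Icc (-R) R).indicator
          (fun s => ‖(chordPolynomial P i z).eval s‖ₑ ^ p) s := by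
      intro s
      have hiff : chordPoint i s z ∈ rhoBallUnion ξ (ε / n) ∩ longChords i ↔
          s ∈ {s | chordPoint i s z ∈ rhoBallUnion ξ (ε / n)} ∩ Set.Icc (-R) R :=
        and_congr_right fun h => iff_of_true (chordPoint_mem_longChords.2 hz)
          ((hball s).1 (norm_le_one_of_mem_rhoBallUnion h))
      simp only [Set.indicator, hF, eval_chordPolynomial]
      congr 1
      exact propext hiff
    have e2 : ∀ s, (Metric.closedBall 0 1).indicator F (chordPoint i s z) =
        (Set.Icc (-R) R).indicator (fun s => ‖(chordPolynomial P i z).eval s‖ₑ ^ p) s := by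
      intro s
      simp only [Set.indicator, mem_closedBall_zero_iff, hF, eval_chordPolynomial, hball]
    simp_rw [e1, e2]
    exact h1
  · have : ∀ s : ℝ, (rhoBallUnion ξ (ε / n) ∩ longChords i).indicator F (chordPoint i s z) = 0 :=
      fun s => Set.indicator_of_notMem (fun h => hz (chordPoint_mem_longChords.1 h.2)) _
    simp [this]

/-- Removing small, well separated `ρ`-balls costs at most half of the `L ^ p` norm. -/
lemma setLIntegral_closedBall_le_two_mul {p : ℝ} (hp : 0 < p) {m n : ℕ}
    {ξ : Fin m → EuclideanSpace ℝ (Fin (d + 1))} (hn : 0 < n)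
    (hξ : ∀ i j, i ≠ j → 1 / (n : ℝ) ≤ rhoB (ξ i) (ξ j)) {ε : ℝ} (hε0 : 0 < ε) (hε : ε < 1 / 4)
    (hεp : 64 * ((d : ℝ) + 1) ^ 2 * ε * Real.exp (p + 1) ≤ 1)
    {P : MvPolynomial (Fin (d + 1)) ℝ} (hP : P.totalDegree ≤ n) :
    ∫⁻ x in Metric.closedBall (0 : EuclideanSpace ℝ (Fin (d + 1))) 1,
        ‖MvPolynomial.eval (fun i => x i) P‖ₑ ^ p ≤
      2 * ∫⁻ x in Metric.closedBall (0 : EuclideanSpace ℝ (Fin (d + 1))) 1 \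
        rhoBallUnion ξ (ε / n), ‖MvPolynomial.eval (fun i => x i) P‖ₑ ^ p := by
  set B := Metric.closedBall (0 : EuclideanSpace ℝ (Fin (d + 1))) 1 with hB
  set E := rhoBallUnion ξ (ε / n) with hE
  set F : EuclideanSpace ℝ (Fin (d + 1)) → ℝ≥0∞ :=
    fun x => ‖MvPolynomial.eval (fun i => x i) P‖ₑ ^ p with hF
  have hEB : E ⊆ B := fun x hx =>
    mem_closedBall_zero_iff.2 (norm_le_one_of_mem_rhoBallUnion hx)
  have hEm : MeasurableSet E := (isClosed_rhoBallUnion ξ (ε / n)).measurableSet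
  have hsum : ∫⁻ x in E, F x ≤ 2⁻¹ * ∫⁻ x in B, F x := by
    have hcov : E ⊆ ⋃ i, E ∩ longChords i := fun x hx => by
      obtain ⟨i, hi⟩ := exists_one_div_le_chord x (norm_le_one_of_mem_rhoBallUnion hx)
      exact Set.mem_iUnion.2 ⟨i, hx, hi⟩
    calc ∫⁻ x in E, F x ≤ ∫⁻ x in ⋃ i, E ∩ longChords i, F x := lintegral_mono_set hcov
      _ ≤ ∑' i, ∫⁻ x in E ∩ longChords i, F x := lintegral_iUnion_le _ _
      _ ≤ ∑' _i : Fin (d + 1), ENNReal.ofReal (32 * ((d : ℝ) + 1) * ε * Real.exp (p + 1)) *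
            ∫⁻ x in B, F x :=
          ENNReal.tsum_le_tsum fun i => setLIntegral_inter_longChords_le hp hn hξ hε0 hε hP i
      _ = ENNReal.ofReal (((d : ℝ) + 1) * (32 * ((d : ℝ) + 1) * ε * Real.exp (p + 1))) *
            ∫⁻ x in B, F x := by
          rw [tsum_fintype, Finset.sum_const, Finset.card_univ, Fintype.card_fin, nsmul_eq_mul,
            ENNReal.ofReal_mul (p := (d : ℝ) + 1) (by positivity), ← mul_assoc, ← Nat.cast_succ,
            ENNReal.ofReal_natCast]
      _ ≤ 2⁻¹ * ∫⁻ x in B, F x := by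
          rw [show (2⁻¹ : ℝ≥0∞) = ENNReal.ofReal 2⁻¹ by
            rw [ENNReal.ofReal_inv_of_pos two_pos, ENNReal.ofReal_ofNat]]
          refine mul_le_mul_of_nonneg_right (ENNReal.ofReal_le_ofReal ?_) zero_le
          linarith
  have hfin : ∫⁻ x in B, F x ≠ ∞ := by
    have hcont : Continuous F :=
      ENNReal.continuous_rpow_const.comp (continuous_eval_coord P).enorm
    obtain ⟨x₀, -, hx₀⟩ := (isCompact_closedBall (0 : EuclideanSpace ℝ (Fin (d + 1))) 1).exists_isMaxOn
      ⟨0, by simp⟩ hcont.continuousOn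
    refine ne_top_of_le_ne_top ?_ (setLIntegral_mono' (g := fun _ => F x₀)
      Metric.isClosed_closedBall.measurableSet hx₀)
    rw [lintegral_const, Measure.restrict_apply MeasurableSet.univ, Set.univ_inter]
    exact ENNReal.mul_ne_top (ENNReal.rpow_ne_top_of_nonneg hp.le enorm_ne_top)
      measure_closedBall_lt_top.ne
  have hsplit : ∫⁻ x in B, F x = (∫⁻ x in E, F x) + ∫⁻ x in B \ E, F x := by
    rw [← lintegral_inter_add_sdiff F B hEm, Set.inter_eq_self_of_subset_right hEB]
  set b := ∫⁻ x in B, F x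
  have h2 : 2⁻¹ * b + 2⁻¹ * b ≤ 2⁻¹ * b + ∫⁻ x in B \ E, F x := by
    rw [← add_mul, ENNReal.inv_two_add_inv_two, one_mul]
    exact hsplit.le.trans (by gcongr)
  have h3 := (ENNReal.add_le_add_iff_left (ENNReal.mul_ne_top (by simp) hfin)).1 h2
  calc b = 2 * (2⁻¹ * b) := by
        rw [← mul_assoc, ENNReal.mul_inv_cancel two_ne_zero ENNReal.ofNat_ne_top, one_mul]
    _ ≤ _ := by gcongr

end ball

section bernstein

variable {G : Polynomial ℂ} {n : ℕ} {M : ℝ}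

lemma norm_laurentLift_le (hG : G.natDegree ≤ n) (hM : ∀ t : ℝ, ‖G.eval (Complex.cos t)‖ ≤ M)
    {w : ℂ} (hw : ‖w‖ ≤ 1) : ‖laurentLift n G w‖ ≤ M := by
  refine Complex.norm_le_of_forall_mem_frontier_norm_le (U := Metric.ball 0 1) Metric.isBounded_ball
    (differentiable_laurentLift n G).diffContOnCl (fun v hv => ?_) ?_
  · rw [frontier_ball _ one_ne_zero, mem_sphere_zero_iff_norm] at hv
    have hv' : v = Complex.exp ((v.arg : ℂ) * Complex.I) := by
      conv_lhs => rw [← Complex.norm_mul_exp_arg_mul_I v, hv, Complex.ofReal_one, one_mul]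
    rw [hv', laurentLift_exp hG, norm_mul, norm_pow, Complex.norm_exp_ofReal_mul_I, one_pow, one_mul]
    exact hM _
  · rwa [closure_ball _ one_ne_zero, mem_closedBall_zero_iff]

lemma norm_eval_cos_le (hG : G.natDegree ≤ n) (hM : ∀ t : ℝ, ‖G.eval (Complex.cos t)‖ ≤ M) (z : ℂ) :
    ‖G.eval (Complex.cos z)‖ ≤ Real.exp (n * |z.im|) * M := by
  wlog hz : 0 ≤ z.im generalizing z
  · simpa using this (-z) (by simpa using (not_le.1 hz).le)
  have hexp : ‖Complex.exp (z * Complex.I)‖ = Real.exp (-z.im) := by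
    simp [Complex.norm_exp]
  have h := norm_laurentLift_le hG hM (w := Complex.exp (z * Complex.I))
    (by rw [hexp]; exact Real.exp_le_one_iff.2 (by linarith))
  rw [laurentLift_exp hG, norm_mul, norm_pow, hexp, ← Real.exp_nat_mul] at h
  calc ‖G.eval (Complex.cos z)‖
      = Real.exp (n * z.im) * (Real.exp (n * -z.im) * ‖G.eval (Complex.cos z)‖) := by
        rw [← mul_assoc, ← Real.exp_add]
        simp
    _ ≤ Real.exp (n * |z.im|) * M := by
        rw [abs_of_nonneg hz]
        gcongr

/-- A Bernstein inequality, with a non-optimal constant. -/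
lemma norm_eval_cos_sub_le (hn : 0 < n) (hG : G.natDegree ≤ n)
    (hM : ∀ t : ℝ, ‖G.eval (Complex.cos t)‖ ≤ M) (t u : ℝ) :
    ‖G.eval (Complex.cos t) - G.eval (Complex.cos u)‖ ≤ n * Real.exp 1 * M * |t - u| := by
  have hn' : (0 : ℝ) < n := by exact_mod_cast hn
  have hM0 : 0 ≤ M := (norm_nonneg _).trans (hM 0)
  have hderiv : ∀ x : ℝ, ‖deriv (fun z : ℂ => G.eval (Complex.cos z)) x‖ ≤ n * Real.exp 1 * M := by
    intro x
    have h := Complex.norm_deriv_le_of_forall_mem_sphere_norm_le (c := (x : ℂ)) (R := 1 / n)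
      (C := Real.exp 1 * M) (by positivity) (differentiable_eval_cos G).diffContOnCl fun z hz => ?_
    · calc _ ≤ Real.exp 1 * M / (1 / n) := h
        _ = n * Real.exp 1 * M := by field_simp
    · refine (norm_eval_cos_le hG hM z).trans ?_
      have him : |z.im| ≤ 1 / n := by
        rw [mem_sphere_iff_norm] at hz
        simpa [hz] using Complex.abs_im_le_norm (z - x)
      gcongr
      calc n * |z.im| ≤ n * (1 / n) := by gcongr
        _ = 1 := by field_simp
  have := Convex.norm_image_sub_le_of_norm_hasDerivWithin_le (s := Set.univ) (x := u) (y := t)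
    (f := fun x : ℝ => G.eval (Complex.cos x))
    (fun x _ => ((differentiable_eval_cos G x).hasDerivAt.comp_ofReal).hasDerivWithinAt)
    (fun x _ => hderiv x) convex_univ (Set.mem_univ _) (Set.mem_univ _)
  simpa [Real.norm_eq_abs] using this

end bernstein

section sup

variable {d : ℕ}

/-- Removing small, well separated `ρ`-balls at most halves the maximum of a polynomial. -/
lemma exists_mem_sdiff_rhoBallUnion {m n : ℕ}
    {ξ : Fin m → EuclideanSpace ℝ (Fin (d + 1))} (hn : 0 < n)
    (hξ : ∀ i j, i ≠ j → 1 / (n : ℝ) ≤ rhoB (ξ i) (ξ j)) {ε : ℝ} (hε : ε < 1 / 4)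
    (hεd : 64 * ((d : ℝ) + 1) * ε ≤ 1)
    {P : MvPolynomial (Fin (d + 1)) ℝ} (hP : P.totalDegree ≤ n)
    {x₀ : EuclideanSpace ℝ (Fin (d + 1))} (hx₀ : ‖x₀‖ ≤ 1)
    (hmax : ∀ x : EuclideanSpace ℝ (Fin (d + 1)), ‖x‖ ≤ 1 →
      |MvPolynomial.eval (fun i => x i) P| ≤ |MvPolynomial.eval (fun i => x₀ i) P|) :
    ∃ x ∈ Metric.closedBall (0 : EuclideanSpace ℝ (Fin (d + 1))) 1 \ rhoBallUnion ξ (ε / n),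
      |MvPolynomial.eval (fun i => x₀ i) P| ≤ 2 * |MvPolynomial.eval (fun i => x i) P| := by
  by_cases hE : x₀ ∈ rhoBallUnion ξ (ε / n)
  swap
  · exact ⟨x₀, ⟨mem_closedBall_zero_iff.2 hx₀, hE⟩, by
      linarith [abs_nonneg (MvPolynomial.eval (fun i => x₀ i) P)]⟩
  set M := |MvPolynomial.eval (fun i => x₀ i) P| with hM
  have hn' : (0 : ℝ) < n := by exact_mod_cast hn
  have hn1 : (1 : ℝ) ≤ n := by exact_mod_cast hn
  obtain ⟨i, hi⟩ := exists_one_div_le_chord x₀ hx₀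
  set z : Fin d → ℝ := fun k => x₀ (i.succAbove k) with hz
  have hx₀z : chordPoint i (x₀ i) z = x₀ := chordPoint_removeNth i x₀
  have hd : 0 < 1 / ((d : ℝ) + 1) := by positivity
  have hnorm : ‖x₀‖ ^ 2 = x₀ i ^ 2 + ∑ k, z k ^ 2 := by
    rw [← norm_chordPoint_sq i, hx₀z]
  have hnorm1 : ‖x₀‖ ^ 2 ≤ 1 := by
    nlinarith [norm_nonneg x₀]
  have hi' : 1 / ((d : ℝ) + 1) ≤ 1 - ∑ k, z k ^ 2 := by linarith
  set R : ℝ := √(1 - ∑ k, z k ^ 2) with hR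
  have hR0 : 0 < R := Real.sqrt_pos.2 (hd.trans_le hi')
  have hR2 : R ^ 2 = 1 - ∑ k, z k ^ 2 := Real.sq_sqrt (hd.trans_le hi').le
  have hx₀R := abs_le.1 (abs_le_of_sq_le_sq (by linarith : x₀ i ^ 2 ≤ R ^ 2) hR0.le)
  set t₀ : ℝ := Real.arccos (x₀ i / R) with ht₀
  have ht₀m : t₀ ∈ Set.Icc 0 Real.pi := ⟨Real.arccos_nonneg _, Real.arccos_le_pi _⟩
  have hcos₀ : R * Real.cos t₀ = x₀ i := by
    rw [ht₀, Real.cos_arccos, mul_div_cancel₀ _ hR0.ne']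
    · rw [le_div_iff₀ hR0]
      linarith
    · rw [div_le_iff₀ hR0]
      linarith
  have hball : ∀ t : ℝ, ‖chordPoint i (R * Real.cos t) z‖ ≤ 1 := by
    intro t
    rw [← sq_le_sq₀ (norm_nonneg _) zero_le_one, norm_chordPoint_sq, one_pow, mul_pow]
    nlinarith [Real.cos_sq_le_one t, sq_nonneg R]
  have h8 : 1 / (8 * (n : ℝ)) ≤ 1 / 8 := by
    gcongr
    linarith
  have hpi := Real.pi_gt_three
  obtain ⟨t, htm, ht⟩ : ∃ t ∈ Set.Icc 0 Real.pi, |t₀ - t| = 1 / (8 * n) := by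
    have h0 : 0 < 1 / (8 * (n : ℝ)) := by positivity
    rcases le_total t₀ (Real.pi / 2) with h | h
    · refine ⟨t₀ + 1 / (8 * n), ⟨by linarith [ht₀m.1], by linarith⟩, ?_⟩
      rw [sub_add_cancel_left, abs_neg, abs_of_pos h0]
    · refine ⟨t₀ - 1 / (8 * n), ⟨by linarith, by linarith [ht₀m.2]⟩, ?_⟩
      rw [show t₀ - (t₀ - 1 / (8 * n)) = 1 / (8 * n) by ring, abs_of_pos h0]
  refine ⟨chordPoint i (R * Real.cos t) z, ⟨mem_closedBall_zero_iff.2 (hball t), fun htE => ?_⟩, ?_⟩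
  · have h := abs_sub_le_of_mem_rhoBallUnion hn hξ hε hR0.le hR2 (hR2 ▸ hi') ht₀m htm
      (by rwa [hcos₀, hx₀z]) htE (by rw [ht]; gcongr; norm_num)
    rw [ht, div_le_div_iff₀ (by positivity) hn'] at h
    have h4 := Real.pi_lt_four
    have h5 : Real.pi * (((d : ℝ) + 1) * ε) * (8 * n) < n := by
      have h6 : Real.pi * (((d : ℝ) + 1) * ε) ≤ Real.pi * (1 / 64) := by
        gcongr
        linarith
      nlinarith
    linarith
  · have hval : ∀ s : ℝ, (complexRescale R (chordPolynomial P i z)).eval (Complex.cos s) =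
        (MvPolynomial.eval (fun j => chordPoint i (R * Real.cos s) z j) P : ℝ) := fun s => by
      rw [eval_complexRescale, eval_chordPolynomial]
    have hb := norm_eval_cos_sub_le hn ((natDegree_complexRescale_le R _).trans
      ((natDegree_chordPolynomial_le P i z).trans hP)) (M := M)
      (fun s => by
        rw [hval, Complex.norm_real]
        exact hmax _ (hball s)) t₀ t
    rw [hval, hval, ← Complex.ofReal_sub, Complex.norm_real, hcos₀, hx₀z, ht] at hb
    have h1 := (abs_sub_abs_le_abs_sub _ _).trans hb
    have h2 : n * Real.exp 1 * M * (1 / (8 * n)) = Real.exp 1 * M / 8 := by field_simp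
    rw [h2, ← hM] at h1
    have h3 := Real.exp_one_lt_three
    nlinarith [abs_nonneg (MvPolynomial.eval (fun i => x₀ i) P)]

/-- A continuous function is bounded on the closed ball minus a closed set by its essential
supremum there. -/
lemma enorm_le_eLpNorm_top_closedBall_sdiff {V : Type*} [NormedAddCommGroup V] [NormedSpace ℝ V]
    [MeasurableSpace V] [BorelSpace V] {μ : Measure V} [μ.IsOpenPosMeasure] {f : V → ℝ}
    (hf : Continuous f) {E : Set V} (hE : IsClosed E) {x : V}
    (hx : x ∈ Metric.closedBall (0 : V) 1 \ E) :
    ‖f x‖ₑ ≤ eLpNorm f ∞ (μ.restrict (Metric.closedBall 0 1 \ E)) := by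
  by_contra! hlt
  set a := eLpNorm f ∞ (μ.restrict (Metric.closedBall 0 1 \ E)) with ha
  have hopen : IsOpen ({y | a < ‖f y‖ₑ} ∩ Eᶜ) :=
    (isOpen_lt continuous_const hf.enorm).inter hE.isOpen_compl
  have hxc : x ∈ closure (Metric.ball (0 : V) 1) := by
    rw [closure_ball _ one_ne_zero]
    exact hx.1
  have hne := mem_closure_iff.1 hxc _ hopen ⟨hlt, hx.2⟩
  refine (hopen.inter Metric.isOpen_ball).measure_ne_zero μ hne ?_
  have hae : ∀ᵐ y ∂μ.restrict (Metric.closedBall 0 1 \ E), ‖f y‖ₑ ≤ a := by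
    rw [ha, eLpNorm_exponent_top]
    exact enorm_ae_le_eLpNormEssSup f _
  rw [ae_restrict_iff' (Metric.isClosed_closedBall.measurableSet.diff hE.measurableSet)] at hae
  refine measure_mono_null (fun y hy => ?_) hae
  intro h
  exact (h ⟨Metric.ball_subset_closedBall hy.2, hy.1.2⟩).not_gt hy.1.1

end sup

/-- Lemma `lem-16-2-0`, Dai–Prymak.
A Remez-type inequality: removing `ρ`-balls of radius `ε/n` around a `1/n`-separated
family of points does not essentially decrease the `L^p` norm of a polynomial of degree
`≤ n` on the unit ball; `ε` depends only on `p` and `d`. -/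
theorem statement19 (d : ℕ) (p : ℝ≥0∞) (hp : 0 < p) :
    ∃ ε : ℝ, ε ∈ Set.Ioo (0 : ℝ) 1 ∧ ∃ C : ℝ≥0, 0 < C ∧
      ∀ n : ℕ, 0 < n →
      ∀ (m : ℕ) (ξ : Fin m → EuclideanSpace ℝ (Fin (d + 1))),
        (∀ i, ‖ξ i‖ ≤ 1) →
        (∀ i j, i ≠ j → 1 / (n : ℝ) ≤ rhoB (ξ i) (ξ j)) →
      ∀ P : MvPolynomial (Fin (d + 1)) ℝ, P.totalDegree ≤ n →
        eLpNorm (fun x : EuclideanSpace ℝ (Fin (d + 1)) =>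
            MvPolynomial.eval (fun i => x i) P) p
          (volume.restrict (Metric.closedBall (0 : EuclideanSpace ℝ (Fin (d + 1))) 1)) ≤
        (C : ℝ≥0∞) *
          eLpNorm (fun x : EuclideanSpace ℝ (Fin (d + 1)) =>
              MvPolynomial.eval (fun i => x i) P) p
            (volume.restrict (Metric.closedBall (0 : EuclideanSpace ℝ (Fin (d + 1))) 1 \
              ⋃ i : Fin m, {η | ‖η‖ ≤ 1 ∧ rhoB (ξ i) η ≤ ε / n})) := by
  have hd : (1 : ℝ) ≤ (d : ℝ) + 1 := by linarith [Nat.cast_nonneg (α := ℝ) d]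
  rcases eq_or_ne p ∞ with rfl | hp'
  · have hd' : 1 / (64 * ((d : ℝ) + 1)) ≤ 1 / 64 := by
      gcongr
      linarith
    refine ⟨1 / (64 * ((d : ℝ) + 1)), ⟨by positivity, by linarith⟩, 2, two_pos, ?_⟩
    intro n hn m ξ _ hξ P hP
    obtain ⟨x₀, hx₀, hmax⟩ := (isCompact_closedBall (0 : EuclideanSpace ℝ (Fin (d + 1)))
      1).exists_isMaxOn ⟨0, by simp⟩ (continuous_eval_coord P).abs.continuousOn
    obtain ⟨x, hx, hle⟩ := exists_mem_sdiff_rhoBallUnion hn hξ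
      (ε := 1 / (64 * ((d : ℝ) + 1))) (by linarith) (by rw [mul_one_div_cancel (by positivity)]) hP
      (mem_closedBall_zero_iff.1 hx₀)
      fun x hx => hmax (mem_closedBall_zero_iff.2 hx)
    calc _ ≤ ‖MvPolynomial.eval (fun i => x₀ i) P‖ₑ := by
          rw [eLpNorm_exponent_top]
          refine essSup_le_of_ae_le _ ?_
          refine (ae_restrict_iff' Metric.isClosed_closedBall.measurableSet).2
            (ae_of_all _ fun y hy => ?_)
          exact enorm_le_iff_norm_le.2 (hmax hy)
      _ ≤ 2 * ‖MvPolynomial.eval (fun i => x i) P‖ₑ := by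
          rw [Real.enorm_eq_ofReal_abs, Real.enorm_eq_ofReal_abs]
          refine (ENNReal.ofReal_le_ofReal hle).trans_eq ?_
          rw [ENNReal.ofReal_mul two_pos.le, ENNReal.ofReal_ofNat]
      _ ≤ _ := by
          gcongr
          · simp
          · exact enorm_le_eLpNorm_top_closedBall_sdiff (continuous_eval_coord P)
              (isClosed_rhoBallUnion ξ _) hx
  · have hq : 0 < p.toReal := ENNReal.toReal_pos hp.ne' hp'
    set q := p.toReal with hqdef
    have hexp : 1 ≤ Real.exp (q + 1) := Real.one_le_exp (by linarith)
    have hbig : 64 ≤ 64 * ((d : ℝ) + 1) ^ 2 * Real.exp (q + 1) := by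
      have : 1 ≤ ((d : ℝ) + 1) ^ 2 * Real.exp (q + 1) :=
        one_le_mul_of_one_le_of_one_le (one_le_pow₀ hd) hexp
      linarith
    have hε : 1 / (64 * ((d : ℝ) + 1) ^ 2 * Real.exp (q + 1)) ≤ 1 / 64 := by gcongr
    refine ⟨1 / (64 * ((d : ℝ) + 1) ^ 2 * Real.exp (q + 1)), ⟨by positivity, by linarith⟩,
      2 ^ (1 / q), by positivity, ?_⟩
    intro n hn m ξ _ hξ P hP
    have key := setLIntegral_closedBall_le_two_mul hq hn hξ
      (ε := 1 / (64 * ((d : ℝ) + 1) ^ 2 * Real.exp (q + 1))) (by positivity) (by linarith)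
      (show 64 * ((d : ℝ) + 1) ^ 2 * (1 / (64 * ((d : ℝ) + 1) ^ 2 * Real.exp (q + 1))) *
        Real.exp (q + 1) ≤ 1 by field_simp; rfl) hP
    rw [eLpNorm_eq_lintegral_rpow_enorm_toReal hp.ne' hp',
      eLpNorm_eq_lintegral_rpow_enorm_toReal hp.ne' hp',
      ENNReal.coe_rpow_of_nonneg _ (by positivity), ← ENNReal.mul_rpow_of_nonneg _ _ (by positivity)]
    exact ENNReal.rpow_le_rpow key (by positivity)
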